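/- Define u_1 = C_{x,1} and u_2 = S_{1,x}, where the subscripts denote the functions f(x) = x and g(x) = 1 (in the indicated order) as inputs to the operators C and S built from the bivariate exponential. Then u_1 and u_2 are twice continuously differentiable on ℝ and satisfy the Airy equation u″ − x u = 0, with u_1(0) = 1, u_1′(0) = 0, u_2(0) = 0, u_2′(0) = 1. -/

import Mathlib

open MeasureTheory intervalIntegral Filter

noncomputable section

/-- Alternating product f(s1)g(s2)f(s3)⋯ with j factors (index 0 ↦ f). -/
def altProd (f g : ℝ → ℂ) (j : ℕ) (s : Fin j → ℝ) : ℂ :=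
  ∏ i : Fin j, if (i : ℕ) % 2 = 0 then f (s i) else g (s i)

/-- The signed simplex integral A_j(f,g,x). -/
def simplexA (f g : ℝ → ℂ) (j : ℕ) (x : ℝ) : ℂ :=
  if 0 ≤ x then
    ∫ s in {s : Fin j → ℝ | StrictMono s ∧ ∀ i, s i ∈ Set.Ioo 0 x}, altProd f g j s
  else
    (-1 : ℂ) ^ j *
      ∫ s in {s : Fin j → ℝ | StrictAnti s ∧ ∀ i, s i ∈ Set.Ioo x 0}, altProd f g j s

/-- The bivariate exponential E_{f,g}. -/
def bivE (f g : ℝ → ℂ) (x : ℝ) : ℂ := 1 + ∑' j : ℕ, simplexA f g (j + 1) x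

def bivC (f g : ℝ → ℂ) (x : ℝ) : ℂ := (bivE f g x + bivE (-f) (-g) x) / 2

def bivS (f g : ℝ → ℂ) (x : ℝ) : ℂ := (bivE f g x - bivE (-f) (-g) x) / 2

/-- Locally absolutely continuous complex-valued function on ℝ. -/
def LocAC (F : ℝ → ℂ) : Prop :=
  ∃ F' : ℝ → ℂ, LocallyIntegrable F' volume ∧
    ∀ x : ℝ, F x = F 0 + ∫ t in (0:ℝ)..x, F' t

end

open Set in
theorem strictMono_mem_Ioo_snoc_iff {n : ℕ} {x t : ℝ} {s : Fin n → ℝ} :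
    (StrictMono (Fin.snoc s t : Fin (n + 1) → ℝ) ∧
        ∀ i, (Fin.snoc s t : Fin (n + 1) → ℝ) i ∈ Ioo 0 x) ↔
      t ∈ Ioo 0 x ∧ StrictMono s ∧ ∀ i, s i ∈ Ioo 0 t := by
  constructor
  · rintro ⟨hm, hI⟩
    have ht := hI (Fin.last n)
    rw [Fin.snoc_last] at ht
    refine ⟨ht, fun i j hij => ?_, fun i => ⟨?_, ?_⟩⟩
    · simpa using hm (Fin.castSucc_lt_castSucc_iff.2 hij)
    · simpa using (hI i.castSucc).1
    · simpa using hm (Fin.castSucc_lt_last i)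
  · rintro ⟨ht, hm, hI⟩
    refine ⟨fun i j hij => ?_, fun i => ?_⟩
    · induction j using Fin.lastCases with
      | last =>
        induction i using Fin.lastCases with
        | last => exact absurd hij (lt_irrefl _)
        | cast i => simpa using (hI i).2
      | cast j =>
        induction i using Fin.lastCases with
        | last => exact absurd hij (not_lt.2 (Fin.le_last _))
        | cast i => simpa using hm (Fin.castSucc_lt_castSucc_iff.1 hij)
    · induction i using Fin.lastCases with
      | last => simpa using ht
      | cast i => simpa using ⟨(hI i).1, (hI i).2.trans ht.2⟩

theorem altProd_snoc (f g : ℝ → ℂ) (n : ℕ) (s : Fin n → ℝ) (t : ℝ) :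
    altProd f g (n + 1) (Fin.snoc s t) =
      (if n % 2 = 0 then f t else g t) * altProd f g n s := by
  simp [altProd, Fin.prod_univ_castSucc, mul_comm]

theorem altProd_neg (f g : ℝ → ℂ) (n : ℕ) (s : Fin n → ℝ) :
    altProd (-f) (-g) n s = (-1) ^ n * altProd f g n s := by
  have h : ∀ i : Fin n, (if (i : ℕ) % 2 = 0 then (-f) (s i) else (-g) (s i)) =
      -(if (i : ℕ) % 2 = 0 then f (s i) else g (s i)) := by
    intro i
    split_ifs <;> rfl
  simp only [altProd, h]
  rw [Finset.prod_neg, Finset.card_univ, Fintype.card_fin]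

theorem simplexA_neg (f g : ℝ → ℂ) (n : ℕ) (x : ℝ) :
    simplexA (-f) (-g) n x = (-1) ^ n * simplexA f g n x := by
  simp only [simplexA, altProd_neg, MeasureTheory.integral_const_mul]
  split_ifs <;> ring

theorem continuous_altProd {f g : ℝ → ℂ} (hf : Continuous f) (hg : Continuous g) (n : ℕ) :
    Continuous (altProd f g n) := by
  refine continuous_finsetProd _ fun i _ => ?_
  split_ifs <;> fun_prop

theorem isOpen_setOf_strictMono_mem_Ioo (n : ℕ) (x : ℝ) :
    IsOpen {s : Fin n → ℝ | StrictMono s ∧ ∀ i, s i ∈ Set.Ioo 0 x} := by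
  simp only [StrictMono, Set.mem_Ioo, Set.ofPred_and, Set.ofPred_forall]
  refine IsOpen.inter ?_ ?_
  · exact isOpen_iInter_of_finite fun i => isOpen_iInter_of_finite fun j =>
      isOpen_iInter_of_finite fun _ => isOpen_lt (continuous_apply i) (continuous_apply j)
  · exact isOpen_iInter_of_finite fun i =>
      (isOpen_lt continuous_const (continuous_apply i)).inter
        (isOpen_lt (continuous_apply i) continuous_const)

theorem integrableOn_altProd {f g : ℝ → ℂ} (hf : Continuous f) (hg : Continuous g)
    (n : ℕ) (x : ℝ) :
    IntegrableOn (altProd f g n) {s : Fin n → ℝ | StrictMono s ∧ ∀ i, s i ∈ Set.Ioo 0 x} :=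
  ((continuous_altProd hf hg n).continuousOn.integrableOn_compact
    (isCompact_univ_pi fun _ => isCompact_Icc (a := (0 : ℝ)) (b := x))).mono_set
    fun _ hs i _ => Set.Ioo_subset_Icc_self (hs.2 i)

theorem simplexA_zero (f g : ℝ → ℂ) (x : ℝ) : simplexA f g 0 x = 1 := by
  have h : ∀ s : Fin 0 → ℝ, StrictMono s ∧ StrictAnti s := fun s =>
    ⟨fun i => i.elim0, fun i => i.elim0⟩
  simp [simplexA, altProd, h, measureReal_def, volume_pi]

theorem simplexA_apply_zero (f g : ℝ → ℂ) (n : ℕ) : simplexA f g (n + 1) 0 = 0 := by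
  simp [simplexA]

theorem simplexA_succ_of_nonneg {f g : ℝ → ℂ} (hf : Continuous f) (hg : Continuous g)
    (n : ℕ) {x : ℝ} (hx : 0 ≤ x) :
    simplexA f g (n + 1) x =
      ∫ t in (0 : ℝ)..x, (if n % 2 = 0 then f t else g t) * simplexA f g n t := by
  let S : (m : ℕ) → ℝ → Set (Fin m → ℝ) := fun m y =>
    {s | StrictMono s ∧ ∀ i, s i ∈ Set.Ioo 0 y}
  have hS : ∀ m y, MeasurableSet (S m y) := fun m y =>
    (isOpen_setOf_strictMono_mem_Ioo m y).measurableSet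
  let e := MeasurableEquiv.piFinSuccAbove (fun _ : Fin (n + 1) => ℝ) (Fin.last n)
  have he : MeasurePreserving e.symm :=
    (volume_preserving_piFinSuccAbove (fun _ : Fin (n + 1) => ℝ) (Fin.last n)).symm
  have he_apply : ∀ p : ℝ × (Fin n → ℝ), e.symm p = Fin.snoc p.2 p.1 := fun p =>
    Fin.insertNth_last' _ _
  let F : (Fin (n + 1) → ℝ) → ℂ := (S (n + 1) x).indicator (altProd f g (n + 1))
  have hF : Integrable F :=
    (integrable_indicator_iff (hS _ _)).2 (integrableOn_altProd hf hg (n + 1) x)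
  have hFe : ∀ t s, F (e.symm (t, s)) = (Set.Ioo 0 x).indicator
      (fun t => (if n % 2 = 0 then f t else g t) * (S n t).indicator (altProd f g n) s) t := by
    intro t s
    classical
    simp only [F, he_apply, Set.indicator_apply, S, Set.mem_ofPred_eq,
      strictMono_mem_Ioo_snoc_iff, altProd_snoc]
    split_ifs <;> simp_all
  have hFe_int : Integrable (fun p => F (e.symm p)) (volume.prod volume) :=
    (he.integrable_comp_emb e.symm.measurableEmbedding).2 hF
  calc simplexA f g (n + 1) x = ∫ s, F s := by
        rw [simplexA, if_pos hx, ← MeasureTheory.integral_indicator (hS _ _)]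
    _ = ∫ p, F (e.symm p) := (he.integral_comp e.symm.measurableEmbedding F).symm
    _ = ∫ t, ∫ s, F (e.symm (t, s)) := integral_prod _ hFe_int
    _ = ∫ t, (Set.Ioo 0 x).indicator
          (fun t => (if n % 2 = 0 then f t else g t) * simplexA f g n t) t := by
        refine integral_congr_ae (ae_of_all _ fun t => ?_)
        simp only [hFe]
        by_cases ht : t ∈ Set.Ioo 0 x
        · simp only [Set.indicator_of_mem ht]
          rw [MeasureTheory.integral_const_mul, MeasureTheory.integral_indicator (hS _ _), simplexA, if_pos ht.1.le]
        · simp only [Set.indicator_of_notMem ht, MeasureTheory.integral_zero]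
    _ = _ := by
        rw [MeasureTheory.integral_indicator measurableSet_Ioo, intervalIntegral.integral_of_le hx,
          integral_Ioc_eq_integral_Ioo]

theorem simplexA_apply_neg (f g : ℝ → ℂ) (n : ℕ) {x : ℝ} (hx : 0 ≤ x) :
    simplexA f g n (-x) = (-1) ^ n * simplexA (fun t => f (-t)) (fun t => g (-t)) n x := by
  rcases hx.eq_or_lt with rfl | hx
  · cases n with
    | zero => simp [simplexA_zero]
    | succ n => simp [simplexA_apply_zero]
  have hpre : {s : Fin n → ℝ | StrictMono s ∧ ∀ i, s i ∈ Set.Ioo 0 x} =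
      (fun s => -s) ⁻¹' {s | StrictAnti s ∧ ∀ i, s i ∈ Set.Ioo (-x) 0} := by
    ext s
    simp [StrictMono, StrictAnti, and_comm]
  rw [simplexA, if_neg (by linarith), simplexA, if_pos hx.le, hpre,
    ← (Measure.measurePreserving_neg (volume : Measure (Fin n → ℝ))).setIntegral_preimage_emb
      (MeasurableEquiv.neg (Fin n → ℝ)).measurableEmbedding]
  rfl

theorem simplexA_succ {f g : ℝ → ℂ} (hf : Continuous f) (hg : Continuous g) (n : ℕ) (x : ℝ) :
    simplexA f g (n + 1) x =
      ∫ t in (0 : ℝ)..x, (if n % 2 = 0 then f t else g t) * simplexA f g n t := by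
  rcases le_total 0 x with hx | hx
  · exact simplexA_succ_of_nonneg hf hg n hx
  obtain ⟨y, rfl⟩ : ∃ y, x = -y := ⟨-x, (neg_neg x).symm⟩
  have hy : 0 ≤ y := neg_nonpos.1 hx
  have hone : (-1 : ℂ) ^ n * (-1) ^ n = 1 := by
    rw [← mul_pow]
    norm_num
  have hcongr : ∀ t ∈ Set.uIcc 0 y,
      (if n % 2 = 0 then f (-t) else g (-t)) *
          simplexA (fun t => f (-t)) (fun t => g (-t)) n t =
        (-1) ^ n * ((if n % 2 = 0 then f (-t) else g (-t)) * simplexA f g n (-t)) := by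
    intro t ht
    rw [simplexA_apply_neg f g n (Set.uIcc_of_le hy ▸ ht).1]
    linear_combination -((if n % 2 = 0 then f (-t) else g (-t)) *
      simplexA (fun t => f (-t)) (fun t => g (-t)) n t) * hone
  rw [simplexA_apply_neg f g _ hy, simplexA_succ_of_nonneg (by fun_prop) (by fun_prop) n hy,
    intervalIntegral.integral_congr hcongr, intervalIntegral.integral_const_mul,
    intervalIntegral.integral_comp_neg fun t => (if n % 2 = 0 then f t else g t) * simplexA f g n t,
    neg_zero, intervalIntegral.integral_symm (-y) 0, pow_succ]
  linear_combination
    -(∫ t in (-y)..0, (if n % 2 = 0 then f t else g t) * simplexA f g n t) * hone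

theorem continuous_simplexA {f g : ℝ → ℂ} (hf : Continuous f) (hg : Continuous g) (n : ℕ) :
    Continuous (simplexA f g n) := by
  induction n with
  | zero => simpa only [funext (simplexA_zero f g)] using continuous_const
  | succ n ih =>
    rw [funext (simplexA_succ hf hg n)]
    refine intervalIntegral.continuous_primitive (fun a b => Continuous.intervalIntegrable ?_ a b) 0
    split_ifs <;> fun_prop

theorem hasDerivAt_simplexA_succ {f g : ℝ → ℂ} (hf : Continuous f) (hg : Continuous g)
    (n : ℕ) (x : ℝ) :
    HasDerivAt (simplexA f g (n + 1))
      ((if n % 2 = 0 then f x else g x) * simplexA f g n x) x := by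
  have hA := continuous_simplexA hf hg n
  rw [funext (simplexA_succ hf hg n)]
  refine (Continuous.integral_hasStrictDerivAt ?_ 0 x).hasDerivAt
  split_ifs <;> fun_prop

theorem norm_simplexA_le {f g : ℝ → ℂ} (hf : Continuous f) (hg : Continuous g) {M R : ℝ}
    (hfM : ∀ t, |t| ≤ R → ‖f t‖ ≤ M) (hgM : ∀ t, |t| ≤ R → ‖g t‖ ≤ M) (n : ℕ) {x : ℝ}
    (hx : |x| ≤ R) :
    ‖simplexA f g n x‖ ≤ (M * |x|) ^ n / n.factorial := by
  have hM : 0 ≤ M := (norm_nonneg _).trans (hfM x hx)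
  induction n generalizing x with
  | zero => simp [simplexA_zero]
  | succ n ih =>
    have hbound : ∀ t ∈ Set.uIoc 0 x,
        ‖(if n % 2 = 0 then f t else g t) * simplexA f g n t‖ ≤
          M ^ (n + 1) / n.factorial * |t - 0| ^ n := by
      intro t ht
      have htx : |t| ≤ R := by
        simpa using (Set.abs_sub_left_of_mem_uIcc (Set.uIoc_subset_uIcc ht)).trans
          (by simpa using hx)
      have hfg : ‖if n % 2 = 0 then f t else g t‖ ≤ M := by
        split_ifs
        exacts [hfM t htx, hgM t htx]
      calc _ ≤ M * ((M * |t|) ^ n / n.factorial) := by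
            rw [norm_mul]
            exact mul_le_mul hfg (ih htx) (norm_nonneg _) hM
        _ = _ := by rw [sub_zero]; ring
    rw [simplexA_succ hf hg]
    calc _ ≤ ∫ t in Set.uIoc 0 x, M ^ (n + 1) / n.factorial * |t - 0| ^ n := by
          rw [intervalIntegral.norm_integral_eq_norm_integral_uIoc]
          refine norm_integral_le_of_norm_le ?_
            ((ae_restrict_iff' measurableSet_uIoc).2 (ae_of_all _ hbound))
          exact Continuous.integrableOn_uIoc (by fun_prop)
      _ = _ := by
          rw [MeasureTheory.integral_const_mul, integral_pow_abs_sub_uIoc, Nat.factorial_succ]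
          push_cast
          rw [sub_zero]
          field_simp
          rw [mul_pow]

theorem summable_simplexA {f g : ℝ → ℂ} (hf : Continuous f) (hg : Continuous g) (x : ℝ) :
    Summable fun n => simplexA f g n x := by
  obtain ⟨M, hM⟩ := (isCompact_Icc (a := -|x|) (b := |x|)).exists_bound_of_continuousOn
    (hf.norm.add hg.norm).continuousOn
  have hM' : ∀ t, |t| ≤ |x| → ‖f t‖ + ‖g t‖ ≤ M := fun t ht =>
    (le_abs_self _).trans (hM t (abs_le.1 ht))
  exact .of_norm_bounded (Real.summable_pow_div_factorial (M * |x|)) fun n =>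
    norm_simplexA_le hf hg (fun t ht => by linarith [hM' t ht, norm_nonneg (g t)])
      (fun t ht => by linarith [hM' t ht, norm_nonneg (f t)]) n le_rfl

theorem hasDerivAt_tsum_simplexA {f g : ℝ → ℂ} (hf : Continuous f) (hg : Continuous g)
    {k : ℕ → ℕ} (hk : Function.Injective k) (x : ℝ) :
    HasDerivAt (fun y => ∑' m, simplexA f g (k m + 1) y)
      (∑' m, (if k m % 2 = 0 then f x else g x) * simplexA f g (k m) x) x := by
  set R := |x| + 1
  obtain ⟨M, hM⟩ := (isCompact_Icc (a := -R) (b := R)).exists_bound_of_continuousOn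
    (hf.norm.add hg.norm).continuousOn
  have hM' : ∀ t, |t| ≤ R → ‖f t‖ + ‖g t‖ ≤ M := fun t ht =>
    (le_abs_self _).trans (hM t (abs_le.1 ht))
  have hfM : ∀ t, |t| ≤ R → ‖f t‖ ≤ M := fun t ht => by
    linarith [hM' t ht, norm_nonneg (g t)]
  have hgM : ∀ t, |t| ≤ R → ‖g t‖ ≤ M := fun t ht => by
    linarith [hM' t ht, norm_nonneg (f t)]
  have hxR : |x| < R := lt_add_one _
  have hM0 : 0 ≤ M := (norm_nonneg _).trans (hfM x hxR.le)
  have hmem : ∀ y ∈ Set.Ioo (-R) R, |y| ≤ R := fun y hy => (abs_lt.2 hy).le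
  refine hasDerivAt_tsum_of_isPreconnected
    (u := fun m => M * ((M * R) ^ k m / (k m).factorial)) (t := Set.Ioo (-R) R)
    (((Real.summable_pow_div_factorial (M * R)).mul_left M).comp_injective hk)
    isOpen_Ioo isPreconnected_Ioo (fun m y _ => hasDerivAt_simplexA_succ hf hg (k m) y)
    (fun m y hy => ?_) (abs_lt.1 hxR)
    ((summable_simplexA hf hg x).comp_injective (i := fun m => k m + 1)
      ((add_left_injective 1).comp hk)) (abs_lt.1 hxR)
  have hy' := hmem y hy
  have hfg : ‖if k m % 2 = 0 then f y else g y‖ ≤ M := by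
    split_ifs
    exacts [hfM y hy', hgM y hy']
  rw [norm_mul]
  refine mul_le_mul hfg ((norm_simplexA_le hf hg hfM hgM _ hy').trans ?_) (norm_nonneg _) hM0
  gcongr

theorem bivE_eq_tsum {f g : ℝ → ℂ} (hf : Continuous f) (hg : Continuous g) (x : ℝ) :
    bivE f g x = ∑' n, simplexA f g n x := by
  rw [(summable_simplexA hf hg x).tsum_eq_zero_add, simplexA_zero, bivE]

theorem bivE_eq_even_add_odd {f g : ℝ → ℂ} (hf : Continuous f) (hg : Continuous g) (x : ℝ) :
    bivE f g x = ∑' m, simplexA f g (2 * m) x + ∑' m, simplexA f g (2 * m + 1) x := by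
  have h := summable_simplexA hf hg x
  rw [bivE_eq_tsum hf hg, ← tsum_even_add_odd (f := fun n => simplexA f g n x)]
  · exact h.comp_injective (i := fun m => 2 * m) fun a b hab => by simpa using hab
  · exact h.comp_injective (i := fun m => 2 * m + 1) fun a b hab => by simpa using hab

theorem bivE_neg_eq_even_sub_odd {f g : ℝ → ℂ} (hf : Continuous f) (hg : Continuous g) (x : ℝ) :
    bivE (-f) (-g) x = ∑' m, simplexA f g (2 * m) x - ∑' m, simplexA f g (2 * m + 1) x := by
  rw [bivE_eq_even_add_odd hf.neg hg.neg]
  simp [simplexA_neg, pow_succ, pow_mul, tsum_neg, sub_eq_add_neg]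

theorem bivC_eq_tsum {f g : ℝ → ℂ} (hf : Continuous f) (hg : Continuous g) (x : ℝ) :
    bivC f g x = ∑' m, simplexA f g (2 * m) x := by
  rw [bivC, bivE_eq_even_add_odd hf hg, bivE_neg_eq_even_sub_odd hf hg]
  ring

theorem bivS_eq_tsum {f g : ℝ → ℂ} (hf : Continuous f) (hg : Continuous g) (x : ℝ) :
    bivS f g x = ∑' m, simplexA f g (2 * m + 1) x := by
  rw [bivS, bivE_eq_even_add_odd hf hg, bivE_neg_eq_even_sub_odd hf hg]
  ring

theorem bivC_zero (f g : ℝ → ℂ) : bivC f g 0 = 1 := by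
  simp [bivC, bivE, simplexA_apply_zero]

theorem bivS_zero (f g : ℝ → ℂ) : bivS f g 0 = 0 := by
  simp [bivS, bivE, simplexA_apply_zero]

theorem hasDerivAt_bivS {f g : ℝ → ℂ} (hf : Continuous f) (hg : Continuous g) (x : ℝ) :
    HasDerivAt (bivS f g) (f x * bivC f g x) x := by
  rw [funext (bivS_eq_tsum hf hg), bivC_eq_tsum hf hg, ← tsum_mul_left]
  simpa using hasDerivAt_tsum_simplexA hf hg (k := fun m => 2 * m)
    (fun a b hab => by simpa using hab) x

theorem hasDerivAt_bivC {f g : ℝ → ℂ} (hf : Continuous f) (hg : Continuous g) (x : ℝ) :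
    HasDerivAt (bivC f g) (g x * bivS f g x) x := by
  have hC : bivC f g = fun y => 1 + ∑' m, simplexA f g (2 * m + 1 + 1) y := by
    funext y
    have h : Summable fun m => simplexA f g (2 * m) y :=
      (summable_simplexA hf hg y).comp_injective (i := fun m => 2 * m)
        fun a b hab => by simpa using hab
    rw [bivC_eq_tsum hf hg, h.tsum_eq_zero_add, mul_zero, simplexA_zero]
    rfl
  rw [hC, bivS_eq_tsum hf hg, ← tsum_mul_left]
  simpa [Nat.add_mod] using (hasDerivAt_tsum_simplexA hf hg (k := fun m => 2 * m + 1)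
    (fun a b hab => by simpa using hab) x).const_add 1

theorem contDiff_two_of_hasDerivAt {u v w : ℝ → ℂ} (hu : ∀ x, HasDerivAt u (v x) x)
    (hv : ∀ x, HasDerivAt v (w x) x) (hw : Continuous w) : ContDiff ℝ 2 u := by
  have hv' : ContDiff ℝ 1 v := contDiff_one_iff_deriv.2
    ⟨fun x => (hv x).differentiableAt, by rwa [funext fun x => (hv x).deriv]⟩
  rw [show (2 : WithTop ℕ∞) = 1 + 1 by norm_num, contDiff_succ_iff_deriv]
  exact ⟨fun x => (hu x).differentiableAt, by simp, by rwa [funext fun x => (hu x).deriv]⟩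

theorem airy_solutions (u₁ u₂ : ℝ → ℂ)
    (hu₁ : u₁ = bivC (fun t => (t : ℂ)) (fun _ => 1))
    (hu₂ : u₂ = bivS (fun _ => 1) (fun t => (t : ℂ))) :
    ContDiff ℝ 2 u₁ ∧ ContDiff ℝ 2 u₂ ∧
    (∀ x : ℝ, deriv (deriv u₁) x - (x : ℂ) * u₁ x = 0) ∧
    (∀ x : ℝ, deriv (deriv u₂) x - (x : ℂ) * u₂ x = 0) ∧
    u₁ 0 = 1 ∧ deriv u₁ 0 = 0 ∧ u₂ 0 = 0 ∧ deriv u₂ 0 = 1 := by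
  have hx : Continuous fun t : ℝ => (t : ℂ) := Complex.continuous_ofReal
  have h1 : Continuous fun _ : ℝ => (1 : ℂ) := continuous_const
  have hC : ∀ x, HasDerivAt u₁ (bivS (fun t => (t : ℂ)) (fun _ => 1) x) x := fun x => by
    simpa [hu₁] using hasDerivAt_bivC hx h1 x
  have hC' : ∀ x : ℝ, HasDerivAt (bivS (fun t => (t : ℂ)) (fun _ => 1)) ((x : ℂ) * u₁ x) x :=
    fun x => by simpa [hu₁] using hasDerivAt_bivS hx h1 x
  have hS : ∀ x, HasDerivAt u₂ (bivC (fun _ => 1) (fun t => (t : ℂ)) x) x := fun x => by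
    simpa [hu₂] using hasDerivAt_bivS h1 hx x
  have hS' : ∀ x : ℝ, HasDerivAt (bivC (fun _ => 1) (fun t => (t : ℂ))) ((x : ℂ) * u₂ x) x :=
    fun x => by simpa [hu₂] using hasDerivAt_bivC h1 hx x
  have hu₁c : Continuous u₁ := continuous_iff_continuousAt.2 fun x => (hC x).continuousAt
  have hu₂c : Continuous u₂ := continuous_iff_continuousAt.2 fun x => (hS x).continuousAt
  refine ⟨contDiff_two_of_hasDerivAt hC hC' (hx.mul hu₁c),
    contDiff_two_of_hasDerivAt hS hS' (hx.mul hu₂c), fun x => ?_, fun x => ?_, ?_, ?_, ?_, ?_⟩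
  · rw [funext fun y => (hC y).deriv, (hC' x).deriv, sub_self]
  · rw [funext fun y => (hS y).deriv, (hS' x).deriv, sub_self]
  · rw [hu₁, bivC_zero]
  · rw [(hC 0).deriv, bivS_zero]
  · rw [hu₂, bivS_zero]
  · rw [(hS 0).deriv, bivC_zero]
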